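/- arXiv:2101.08761 — 2 statements merged into one kernel-verified Lean document; each statement's English description precedes it below -/
import Mathlib

section
/- Let p be a prime that does not divide 9240. Then p ≡ 1 (mod 12) and (−35/p) = (−32/p) = (−27/p) = (−20/p) = (−11/p) = 1 hold simultaneously if and only if p mod 9240 ∈ {1, 169, 289, 361, 529, 841, 961, 1369, 1681, 1849, 2209, 2641, 2689, 2809, 3481, 3529, 3721, 4321, 4489, 5041, 5329, 5569, 6169, 6241, 6889, 7561, 7681, 7921, 8089, 8761}. -/
/-- For `p ≡ 1 [MOD 4]`, the Legendre symbol of an odd natural number `q` modulo `p` equals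
the Jacobi symbol of the residue `p % q` modulo `q`. -/
theorem legendreSym_eq_jacobiSym_mod_of_one_mod_four {p : ℕ} [Fact p.Prime] (h : p % 4 = 1)
    {q : ℕ} (hq : Odd q) : legendreSym p q = jacobiSym ((p % q : ℕ) : ℤ) q := by
  rw [jacobiSym.legendreSym.to_jacobiSym,
    ← jacobiSym.quadratic_reciprocity_one_mod_four h hq, jacobiSym.mod_left]
  norm_cast

theorem legendreSym_five_eq_one_iff {p : ℕ} [Fact p.Prime] (h : p % 4 = 1) :
    legendreSym p 5 = 1 ↔ p % 5 = 1 ∨ p % 5 = 4 := by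
  have e := legendreSym_eq_jacobiSym_mod_of_one_mod_four h (q := 5) (by decide)
  rw [show (5 : ℤ) = ((5 : ℕ) : ℤ) from rfl, e]
  have hlt := Nat.mod_lt p (show 5 > 0 by norm_num)
  generalize p % 5 = r at hlt ⊢
  interval_cases r <;> norm_num

theorem legendreSym_seven_eq_one_iff {p : ℕ} [Fact p.Prime] (h : p % 4 = 1) :
    legendreSym p 7 = 1 ↔ p % 7 = 1 ∨ p % 7 = 2 ∨ p % 7 = 4 := by
  have e := legendreSym_eq_jacobiSym_mod_of_one_mod_four h (q := 7) (by decide)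
  rw [show (7 : ℤ) = ((7 : ℕ) : ℤ) from rfl, e]
  have hlt := Nat.mod_lt p (show 7 > 0 by norm_num)
  generalize p % 7 = r at hlt ⊢
  interval_cases r <;> norm_num

theorem legendreSym_eleven_eq_one_iff {p : ℕ} [Fact p.Prime] (h : p % 4 = 1) :
    legendreSym p 11 = 1 ↔
      p % 11 = 1 ∨ p % 11 = 3 ∨ p % 11 = 4 ∨ p % 11 = 5 ∨ p % 11 = 9 := by
  have e := legendreSym_eq_jacobiSym_mod_of_one_mod_four h (q := 11) (by decide)
  rw [show (11 : ℤ) = ((11 : ℕ) : ℤ) from rfl, e]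
  have hlt := Nat.mod_lt p (show 11 > 0 by norm_num)
  generalize p % 11 = r at hlt ⊢
  interval_cases r <;> norm_num

theorem legendreSym_three_eq_one_iff {p : ℕ} [Fact p.Prime] (h : p % 4 = 1) :
    legendreSym p 3 = 1 ↔ p % 3 = 1 := by
  have e := legendreSym_eq_jacobiSym_mod_of_one_mod_four h (q := 3) (by decide)
  rw [show (3 : ℤ) = ((3 : ℕ) : ℤ) from rfl, e]
  have hlt := Nat.mod_lt p (show 3 > 0 by norm_num)
  generalize p % 3 = r at hlt ⊢
  interval_cases r <;> norm_num

theorem legendreSym_two_eq_one_iff {p : ℕ} [Fact p.Prime] (h : p % 4 = 1) :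
    legendreSym p 2 = 1 ↔ p % 8 = 1 := by
  have hodd : Odd p := Nat.odd_iff.2 (by omega)
  rw [jacobiSym.legendreSym.to_jacobiSym, jacobiSym.mod_right 2 hodd]
  have h8 : p % 8 = 1 ∨ p % 8 = 5 := by omega
  rcases h8 with h8 | h8 <;> simp only [show 4 * (2 : ℤ).natAbs = 8 from rfl, h8] <;>
    norm_num

theorem legendreSym_neg_of_one_mod_four {p : ℕ} [Fact p.Prime] (h : p % 4 = 1) (a : ℤ) :
    legendreSym p (-a) = legendreSym p a := by
  rw [neg_eq_neg_one_mul, legendreSym.mul, legendreSym.at_neg_one (by omega),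
    ZMod.χ₄_nat_one_mod_four h, one_mul]

theorem legendreSym_mul_sq {p : ℕ} [Fact p.Prime] (a : ℤ) {b : ℤ} (hb : (b : ZMod p) ≠ 0) :
    legendreSym p (a * b ^ 2) = legendreSym p a := by
  rw [legendreSym.mul, legendreSym.sq_one' p hb, mul_one]

/-- The symbols at `-35, -32, -27, -20, -11` for `p ≡ 1 [MOD 12]`, as congruences on `p`. -/
theorem legendreSym_conditions_iff {p : ℕ} [Fact p.Prime] (h : p % 12 = 1) :
    (legendreSym p (-35) = 1 ∧ legendreSym p (-32) = 1 ∧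
      legendreSym p (-27) = 1 ∧ legendreSym p (-20) = 1 ∧ legendreSym p (-11) = 1) ↔
    (p % 8 = 1 ∧ (p % 5 = 1 ∨ p % 5 = 4) ∧ (p % 7 = 1 ∨ p % 7 = 2 ∨ p % 7 = 4) ∧
      (p % 11 = 1 ∨ p % 11 = 3 ∨ p % 11 = 4 ∨ p % 11 = 5 ∨ p % 11 = 9)) := by
  have h4 : p % 4 = 1 := by omega
  have h3 : p % 3 = 1 := by omega
  have ndvd (n : ℕ) (hn : 0 < n) (hn' : n < 12) : (((n : ℕ) : ℤ) : ZMod p) ≠ 0 := by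
    have hp1 := (Fact.out : p.Prime).one_lt
    rw [Int.cast_natCast, Ne, ZMod.natCast_eq_zero_iff]
    intro hd
    have := Nat.le_of_dvd hn hd
    omega
  have e32 : legendreSym p 32 = legendreSym p 2 :=
    legendreSym_mul_sq 2 (ndvd 4 (by norm_num) (by norm_num))
  have e27 : legendreSym p 27 = legendreSym p 3 :=
    legendreSym_mul_sq 3 (ndvd 3 (by norm_num) (by norm_num))
  have e20 : legendreSym p 20 = legendreSym p 5 :=
    legendreSym_mul_sq 5 (ndvd 2 (by norm_num) (by norm_num))
  have e35 : legendreSym p 35 = legendreSym p 5 * legendreSym p 7 := legendreSym.mul p 5 7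
  simp only [legendreSym_neg_of_one_mod_four h4, e32, e27, e20, e35]
  rw [← legendreSym_two_eq_one_iff h4, ← legendreSym_five_eq_one_iff h4,
    ← legendreSym_seven_eq_one_iff h4, ← legendreSym_eleven_eq_one_iff h4]
  have t := (legendreSym_three_eq_one_iff h4).2 h3
  constructor
  · rintro ⟨a, b, -, c, d⟩
    exact ⟨b, c, by simpa [c] using a, d⟩
  · rintro ⟨b, c, a, d⟩
    exact ⟨by simp [a, c], b, t, c, d⟩

theorem stmt_12 (p : ℕ) [Fact p.Prime] (hp : ¬ p ∣ 9240) :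
    (p % 12 = 1 ∧ legendreSym p (-35) = 1 ∧ legendreSym p (-32) = 1 ∧
      legendreSym p (-27) = 1 ∧ legendreSym p (-20) = 1 ∧ legendreSym p (-11) = 1) ↔
    p % 9240 ∈ ({1, 169, 289, 361, 529, 841, 961, 1369, 1681, 1849, 2209, 2641,
      2689, 2809, 3481, 3529, 3721, 4321, 4489, 5041, 5329, 5569, 6169, 6241,
      6889, 7561, 7681, 7921, 8089, 8761} : Finset ℕ) := by
  rw [and_congr_right fun h => legendreSym_conditions_iff h]
  have key : ∀ k < 385, ((24 * k + 1) % 5 = 1 ∨ (24 * k + 1) % 5 = 4) ∧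
      ((24 * k + 1) % 7 = 1 ∨ (24 * k + 1) % 7 = 2 ∨ (24 * k + 1) % 7 = 4) ∧
      ((24 * k + 1) % 11 = 1 ∨ (24 * k + 1) % 11 = 3 ∨ (24 * k + 1) % 11 = 4 ∨
        (24 * k + 1) % 11 = 5 ∨ (24 * k + 1) % 11 = 9) →
      24 * k + 1 ∈ ({1, 169, 289, 361, 529, 841, 961, 1369, 1681, 1849, 2209, 2641,
        2689, 2809, 3481, 3529, 3721, 4321, 4489, 5041, 5329, 5569, 6169, 6241,
        6889, 7561, 7681, 7921, 8089, 8761} : Finset ℕ) := by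
    decide +kernel
  constructor
  · rintro ⟨h12, h8, h5, h7, h11⟩
    have hr : p % 9240 = 24 * (p % 9240 / 24) + 1 := by omega
    have hm (n : ℕ) (hn : n ∣ 9240) : (24 * (p % 9240 / 24) + 1) % n = p % n := by
      rw [← hr, Nat.mod_mod_of_dvd p hn]
    rw [hr]
    apply key _ (by omega)
    rw [hm 5 (by norm_num), hm 7 (by norm_num), hm 11 (by norm_num)]
    exact ⟨h5, h7, h11⟩
  · intro h
    simp only [Finset.mem_insert, Finset.mem_singleton] at h
    rcases h with h | h | h | h | h | h | h | h | h | h | h | h | h | h | h | h | h | h | h | h |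
      h | h | h | h | h | h | h | h | h | h <;> omega
end

section
/- Let p be a prime that does not divide 2760. Then p ≡ 1 (mod 12) and (3/p) = (−5/p) = (−8/p) = (−23/p) = 1 hold simultaneously if and only if p mod 2760 ∈ {1, 49, 121, 169, 289, 361, 409, 601, 721, 841, 961, 1129, 1369, 1681, 1729, 1849, 1921, 2209, 2281, 2329, 2401, 2569}. -/
theorem legendreSym_neg_prime_eq {p q : ℕ} [Fact p.Prime] [Fact q.Prime] (hp : p % 4 = 1)
    (hq : q ≠ 2) : legendreSym p (-q) = legendreSym q p := by
  have hp2 : p ≠ 2 := by omega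
  rw [neg_eq_neg_one_mul, legendreSym.mul, legendreSym.at_neg_one hp2,
    ZMod.χ₄_nat_one_mod_four hp, one_mul]
  exact (legendreSym.quadratic_reciprocity_one_mod_four hp hq).symm

theorem legendreSym_three_eq_one_iff_s13 [Fact (Nat.Prime 3)] (n : ℕ) :
    legendreSym 3 n = 1 ↔ n % 3 = 1 := by
  rw [legendreSym.mod]
  have h := Nat.mod_lt n (show 3 > 0 by norm_num)
  norm_cast
  interval_cases n % 3 <;> norm_num

theorem legendreSym_five_eq_one_iff_s13 [Fact (Nat.Prime 5)] (n : ℕ) :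
    legendreSym 5 n = 1 ↔ n % 5 ∈ ({1, 4} : Finset ℕ) := by
  rw [legendreSym.mod]
  have h := Nat.mod_lt n (show 5 > 0 by norm_num)
  norm_cast
  interval_cases n % 5 <;> norm_num

theorem legendreSym_twentythree_eq_one_iff [Fact (Nat.Prime 23)] (n : ℕ) :
    legendreSym 23 n = 1 ↔
      n % 23 ∈ ({1, 2, 3, 4, 6, 8, 9, 12, 13, 16, 18} : Finset ℕ) := by
  rw [legendreSym.mod]
  have h := Nat.mod_lt n (show 23 > 0 by norm_num)
  norm_cast
  interval_cases n % 23 <;> norm_num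

theorem legendreSym_neg_eight_eq_one_iff {p : ℕ} [Fact p.Prime] (hp : p % 4 = 1) :
    legendreSym p (-8) = 1 ↔ p % 8 = 1 := by
  have hp2 : p ≠ 2 := by omega
  have h2 : ((2 : ℤ) : ZMod p) ≠ 0 := by
    intro h
    rw [ZMod.intCast_zmod_eq_zero_iff_dvd] at h
    have := Nat.le_of_dvd two_pos (Int.natCast_dvd_natCast.mp h)
    have := (Fact.out : p.Prime).two_le
    omega
  rw [show (-8 : ℤ) = 2 ^ 2 * -2 by norm_num, legendreSym.mul, legendreSym.sq_one' p h2, one_mul,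
    legendreSym.at_neg_two hp2, ZMod.χ₈'_nat_eq_if_mod_eight]
  split_ifs <;> simp <;> omega

theorem mod_2760_mem_iff (n : ℕ) :
    n % 2760 ∈ ({1, 49, 121, 169, 289, 361, 409, 601, 721, 841, 961, 1129, 1369,
      1681, 1729, 1849, 1921, 2209, 2281, 2329, 2401, 2569} : Finset ℕ) ↔
    n % 12 = 1 ∧ n % 3 = 1 ∧ n % 5 ∈ ({1, 4} : Finset ℕ) ∧ n % 8 = 1 ∧
      n % 23 ∈ ({1, 2, 3, 4, 6, 8, 9, 12, 13, 16, 18} : Finset ℕ) := by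
  have mem_mod : ∀ r ∈ ({1, 49, 121, 169, 289, 361, 409, 601, 721, 841, 961, 1129, 1369,
        1681, 1729, 1849, 1921, 2209, 2281, 2329, 2401, 2569} : Finset ℕ),
      r % 24 = 1 := by
    decide
  have key : ∀ k < 115,
      24 * k + 1 ∈ ({1, 49, 121, 169, 289, 361, 409, 601, 721, 841, 961, 1129, 1369,
        1681, 1729, 1849, 1921, 2209, 2281, 2329, 2401, 2569} : Finset ℕ) ↔
      (24 * k + 1) % 5 ∈ ({1, 4} : Finset ℕ) ∧
        (24 * k + 1) % 23 ∈ ({1, 2, 3, 4, 6, 8, 9, 12, 13, 16, 18} : Finset ℕ) := by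
    decide +kernel
  by_cases h24 : n % 24 = 1
  · have h := key (n % 2760 / 24) (by omega)
    rw [show 24 * (n % 2760 / 24) + 1 = n % 2760 by omega,
      Nat.mod_mod_of_dvd n (show 5 ∣ 2760 by norm_num),
      Nat.mod_mod_of_dvd n (show 23 ∣ 2760 by norm_num)] at h
    rw [h]
    have h12 : n % 12 = 1 := by omega
    have h3 : n % 3 = 1 := by omega
    have h8 : n % 8 = 1 := by omega
    simp only [h12, h3, h8, true_and]
  · refine iff_of_false (fun h => ?_) (fun h => ?_)
    · have := mem_mod _ h
      omega
    · omega

theorem stmt_13 (p : ℕ) [Fact p.Prime] (hp : ¬ p ∣ 2760) :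
    (p % 12 = 1 ∧ legendreSym p 3 = 1 ∧ legendreSym p (-5) = 1 ∧
      legendreSym p (-8) = 1 ∧ legendreSym p (-23) = 1) ↔
    p % 2760 ∈ ({1, 49, 121, 169, 289, 361, 409, 601, 721, 841, 961, 1129, 1369,
      1681, 1729, 1849, 1921, 2209, 2281, 2329, 2401, 2569} : Finset ℕ) := by
  rw [mod_2760_mem_iff]
  refine and_congr_right fun h12 => ?_
  have h4 : p % 4 = 1 := by omega
  have : Fact (Nat.Prime 3) := ⟨by norm_num⟩
  have : Fact (Nat.Prime 5) := ⟨by norm_num⟩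
  have : Fact (Nat.Prime 23) := ⟨by norm_num⟩
  have h3 : legendreSym p 3 = legendreSym 3 p :=
    (legendreSym.quadratic_reciprocity_one_mod_four (q := 3) h4 (by norm_num)).symm
  have h5 : legendreSym p (-5) = legendreSym 5 p :=
    legendreSym_neg_prime_eq (q := 5) h4 (by norm_num)
  have h23 : legendreSym p (-23) = legendreSym 23 p :=
    legendreSym_neg_prime_eq (q := 23) h4 (by norm_num)
  rw [h3, h5, h23, legendreSym_three_eq_one_iff_s13, legendreSym_five_eq_one_iff_s13,
    legendreSym_neg_eight_eq_one_iff h4, legendreSym_twentythree_eq_one_iff]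
end
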